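/- arXiv:2506.21741 — 7 statements merged into one kernel-verified Lean document; each statement's English description precedes it below -/
import Mathlib

section
/- Let n ≥ 2 and ξ ∈ ℝ. For every choice of real numbers γ_1, …, γ_{n−1}, the characteristic polynomial of F(γ, ξ), viewed over ℂ, has a root λ with Re(λ) ≥ −ξ/n. In other words, the maximum real part of the eigenvalues of F(γ, ξ) is at least −ξ/n, so no parameter choice can beat the critically damped value −ξ/n. -/
open Matrix

/-- The n×n forward-process matrix `F(γ, ξ)` with (1-based) entries
`F[i, i+1] = γ_i`, `F[i+1, i] = −γ_i` for `1 ≤ i ≤ n−1`, `F[n, n] = −ξ`,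
and zeros elsewhere. -/
def Fmat (n : ℕ) (γ : ℕ → ℝ) (ξ : ℝ) : Matrix (Fin n) (Fin n) ℝ :=
  fun i j =>
    (if (j : ℕ) = (i : ℕ) + 1 then γ ((i : ℕ) + 1) else 0) +
    (if (i : ℕ) = (j : ℕ) + 1 then -γ ((j : ℕ) + 1) else 0) +
    (if (i : ℕ) = n - 1 ∧ (j : ℕ) = n - 1 then -ξ else 0)

theorem trace_Fmat {n : ℕ} (hn : 0 < n) (γ : ℕ → ℝ) (ξ : ℝ) :
    (Fmat n γ ξ).trace = -ξ := by
  have h : ∀ i : Fin n, Fmat n γ ξ i i = if i = ⟨n - 1, by omega⟩ then -ξ else 0 := by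
    intro i
    simp [Fmat, Fin.ext_iff]
  simp [Matrix.trace, h]

theorem exists_charpoly_isRoot_trace_re_div_le {n : ℕ} (hn : 0 < n)
    (A : Matrix (Fin n) (Fin n) ℂ) :
    ∃ μ : ℂ, A.charpoly.IsRoot μ ∧ A.trace.re / n ≤ μ.re := by
  have hcard : A.charpoly.roots.card = n := by
    rw [← (IsAlgClosed.splits A.charpoly).natDegree_eq_card_roots, A.charpoly_natDegree_eq_dim,
      Fintype.card_fin]
  have hsum : A.trace.re = (A.charpoly.roots.map Complex.re).sum := by
    rw [A.trace_eq_sum_roots_charpoly]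
    exact map_multiset_sum Complex.reAddGroupHom _
  by_contra! hlt
  have hn' : (0 : ℝ) < n := by exact_mod_cast hn
  have hne : A.charpoly.roots ≠ 0 := by
    rintro h
    simp [h] at hcard
    omega
  have key : (A.charpoly.roots.map Complex.re).sum <
      (A.charpoly.roots.map fun _ => A.trace.re / n).sum :=
    Multiset.sum_lt_sum_of_nonempty hne fun μ hμ => hlt μ (Polynomial.isRoot_of_mem_roots hμ)
  rw [Multiset.map_const', Multiset.sum_replicate, hcard, nsmul_eq_mul,
    mul_div_cancel₀ _ hn'.ne', ← hsum] at key
  exact lt_irrefl _ key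

theorem stmt_1 {n : ℕ} (hn : 2 ≤ n) (ξ : ℝ) (γ : ℕ → ℝ) :
    ∃ μ : ℂ, ((Fmat n γ ξ).map (Complex.ofReal : ℝ → ℂ)).charpoly.IsRoot μ ∧
      -ξ / n ≤ μ.re := by
  have htr : (((Fmat n γ ξ).map (Complex.ofReal : ℝ → ℂ)).trace).re = -ξ := by
    have h := AddMonoidHom.map_trace Complex.ofRealHom.toAddMonoidHom (Fmat n γ ξ)
    rw [trace_Fmat (by omega)] at h
    exact (congrArg Complex.re h).symm
  rw [← htr]
  exact exists_charpoly_isRoot_trace_re_div_le (by omega) _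
end

section
/- Let n ≥ 2 and let λ* < 0 be a real number. With the critically damped parameters γ_{n−i} = |λ*|·√((n²−i²)/(4i²−1)) for i = 1, …, n−1 and ξ = n·|λ*|, the characteristic polynomial of the n×n matrix F(γ, ξ) equals (X − λ*)ⁿ; in particular λ* is the unique eigenvalue of F(γ, ξ), with algebraic multiplicity n. -/
open Matrix Polynomial

/-- The `k × k` tridiagonal matrix with diagonal `x, …, x, x + ξ`, whose off-diagonal entries,
read from the bottom right corner upwards, are `-g 1, -g 2, …` above the diagonal and
`g 1, g 2, …` below it. -/
def skewTridiag (g : ℕ → ℝ) (x ξ : ℝ) (k : ℕ) : Matrix (Fin k) (Fin k) ℝ :=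
  fun i j =>
    if (i : ℕ) = j then (if (i : ℕ) + 1 = k then x + ξ else x)
    else if (j : ℕ) = i + 1 then -g (k - 1 - i)
    else if (i : ℕ) = j + 1 then g (k - 1 - j)
    else 0

theorem skewTridiag_submatrix_succ (g : ℕ → ℝ) (x ξ : ℝ) (k : ℕ) :
    (skewTridiag g x ξ (k + 1)).submatrix Fin.succ Fin.succ = skewTridiag g x ξ k := by
  ext i j
  simp [skewTridiag, Nat.sub_add_eq, Nat.sub_right_comm]

theorem det_skewTridiag_add_two (g : ℕ → ℝ) (x ξ : ℝ) (k : ℕ) :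
    (skewTridiag g x ξ (k + 2)).det =
      x * (skewTridiag g x ξ (k + 1)).det + g (k + 1) ^ 2 * (skewTridiag g x ξ k).det := by
  have minor : ((skewTridiag g x ξ (k + 2)).submatrix Fin.succ (Fin.succAbove 1)).det =
      g (k + 1) * (skewTridiag g x ξ k).det := by
    rw [det_succ_column_zero, Fin.sum_univ_succ, Finset.sum_eq_zero]
    · have hsub : ((skewTridiag g x ξ (k + 2)).submatrix Fin.succ (Fin.succAbove 1)).submatrix
          (Fin.succAbove 0) Fin.succ = skewTridiag g x ξ k := by
        rw [← skewTridiag_submatrix_succ g x ξ k, ← skewTridiag_submatrix_succ g x ξ (k + 1)]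
        ext i j
        have : (Fin.succAbove (1 : Fin (k + 2)) j.succ) = j.succ.succ := by
          rw [← Fin.succ_zero_eq_one, Fin.succ_succAbove_succ, Fin.succAbove_zero]
        simp [this]
      rw [hsub]
      simp [skewTridiag]
    · intro i _
      simp [skewTridiag]
  rw [det_succ_row_zero, Fin.sum_univ_succ, Fin.sum_univ_succ, Finset.sum_eq_zero]
  · have h0 : (skewTridiag g x ξ (k + 2)).submatrix Fin.succ (Fin.succAbove 0) =
        skewTridiag g x ξ (k + 1) := by
      rw [← skewTridiag_submatrix_succ g x ξ (k + 1), Fin.succAbove_zero]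
    rw [h0, Fin.succ_zero_eq_one, minor]
    simp [skewTridiag]
    ring
  · intro i _
    simp [skewTridiag]

/-- The coefficient of `(X + 1) ^ s` in the monic Jacobi polynomial of degree `s + d` with
parameters `(ν, -ν)`. -/
noncomputable def jacobiCoeff (ν : ℝ) (s d : ℕ) : ℝ :=
  ((2 * s + d).factorial : ℝ) / (s.factorial * d.factorial) *
    (∏ j ∈ Finset.range d, (ν - 1 - s - j)) * 2 ^ d *
    (s + d).factorial / (2 * (s + d)).factorial

/-- The monic Jacobi polynomial of degree `k` with parameters `(ν, -ν)`, in the variable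
shifted by `1`. -/
noncomputable def shiftedJacobi (ν : ℝ) (k : ℕ) : ℝ[X] :=
  ∑ s ∈ Finset.range (k + 1), C (jacobiCoeff ν s (k - s)) * X ^ s

theorem coeff_shiftedJacobi (ν : ℝ) (k s : ℕ) :
    (shiftedJacobi ν k).coeff s = if s ≤ k then jacobiCoeff ν s (k - s) else 0 := by
  simp [shiftedJacobi, finsetSum_coeff, coeff_X_pow]

theorem jacobiCoeff_zero_right (ν : ℝ) (s : ℕ) : jacobiCoeff ν s 0 = 1 := by
  have h1 := s.factorial_ne_zero
  have h2 := (2 * s).factorial_ne_zero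
  simp only [jacobiCoeff]
  simp
  field_simp

theorem jacobiCoeff_one_right (ν : ℝ) (s : ℕ) : jacobiCoeff ν s 1 = ν - 1 - s := by
  have h1 := s.factorial_ne_zero
  have h2 := (2 * s).factorial_ne_zero
  have e : 2 * (s + 1) = 2 * s + 1 + 1 := by ring
  simp only [jacobiCoeff, e, Nat.factorial_succ]
  push_cast
  simp
  field_simp
  ring

theorem jacobiCoeff_zero_left_add_two (ν : ℝ) (d : ℕ) :
    jacobiCoeff ν 0 (d + 2) = -jacobiCoeff ν 0 (d + 1) +
      (ν ^ 2 - (d + 1) ^ 2) / (4 * (d + 1) ^ 2 - 1) * jacobiCoeff ν 0 d := by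
  have h1 := d.factorial_ne_zero
  have h2 := (2 * d).factorial_ne_zero
  have e1 : 2 * (d + 1) = 2 * d + 1 + 1 := by ring
  have e2 : 2 * (d + 2) = 2 * d + 1 + 1 + 1 + 1 := by ring
  have e3 : (4 * ((d : ℝ) + 1) ^ 2 - 1) = (2 * d + 1) * (2 * d + 3) := by ring
  rw [e3]
  simp only [jacobiCoeff, zero_add, mul_zero, e1, e2, Nat.factorial_succ,
    Finset.prod_range_succ, pow_succ]
  push_cast
  generalize (∏ j ∈ Finset.range d, (ν - 1 - (0 : ℝ) - (j : ℝ))) = Q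
  have : (2 * (d : ℝ) + 1 + 1 + 1) ≠ 0 := by positivity
  field_simp
  ring

theorem jacobiCoeff_succ_add_two (ν : ℝ) (s d : ℕ) :
    jacobiCoeff ν (s + 1) (d + 2) = jacobiCoeff ν s (d + 2) - jacobiCoeff ν (s + 1) (d + 1) +
      (ν ^ 2 - (s + d + 2) ^ 2) / (4 * (s + d + 2) ^ 2 - 1) * jacobiCoeff ν (s + 1) d := by
  have h0 := s.factorial_ne_zero
  have h1 := d.factorial_ne_zero
  have h2 := (2 * s + d).factorial_ne_zero
  have h3 := (s + d).factorial_ne_zero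
  have h4 := (2 * (s + d)).factorial_ne_zero
  have e1 : 2 * (s + 1 + (d + 2)) = 2 * (s + d) + 1 + 1 + 1 + 1 + 1 + 1 := by ring
  have e2 : 2 * (s + (d + 2)) = 2 * (s + d) + 1 + 1 + 1 + 1 := by ring
  have e3 : 2 * (s + 1 + (d + 1)) = 2 * (s + d) + 1 + 1 + 1 + 1 := by ring
  have e4 : 2 * (s + 1 + d) = 2 * (s + d) + 1 + 1 := by ring
  have f1 : 2 * (s + 1) + (d + 2) = 2 * s + d + 1 + 1 + 1 + 1 := by ring
  have f2 : 2 * s + (d + 2) = 2 * s + d + 1 + 1 := by ring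
  have f3 : 2 * (s + 1) + (d + 1) = 2 * s + d + 1 + 1 + 1 := by ring
  have f4 : 2 * (s + 1) + d = 2 * s + d + 1 + 1 := by ring
  have g1 : s + 1 + (d + 2) = s + d + 1 + 1 + 1 := by ring
  have g2 : s + (d + 2) = s + d + 1 + 1 := by ring
  have g3 : s + 1 + (d + 1) = s + d + 1 + 1 := by ring
  have g4 : s + 1 + d = s + d + 1 := by ring
  have e : (4 * ((s : ℝ) + d + 2) ^ 2 - 1) = (2 * (s + d) + 3) * (2 * (s + d) + 5) := by ring
  have hprod : ∏ j ∈ Finset.range (d + 2), (ν - 1 - (s : ℝ) - j) =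
      (ν - 1 - s) * (∏ j ∈ Finset.range d, (ν - 1 - ((s + 1 : ℕ) : ℝ) - j)) *
        (ν - 1 - s - (d + 1)) := by
    rw [Finset.prod_range_succ, Finset.prod_range_succ']
    have : ∀ j : ℕ, ν - 1 - (s : ℝ) - ((j + 1 : ℕ) : ℝ) = ν - 1 - ((s + 1 : ℕ) : ℝ) - j := by
      intro j; push_cast; ring
    simp only [this]
    push_cast
    ring
  simp only [jacobiCoeff, hprod, e]
  rw [e1, e2, e3, e4, f1, f2, f3, f4, g1, g2, g3, g4]
  simp only [Nat.factorial_succ, Finset.prod_range_succ, pow_succ]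
  generalize (∏ j ∈ Finset.range d, (ν - 1 - ((s + 1 : ℕ) : ℝ) - (j : ℝ))) = Q
  push_cast
  field_simp
  ring

theorem shiftedJacobi_zero (ν : ℝ) : shiftedJacobi ν 0 = 1 := by
  simp [shiftedJacobi, jacobiCoeff_zero_right]

theorem shiftedJacobi_one (ν : ℝ) : shiftedJacobi ν 1 = X - 1 + C ν := by
  simp [shiftedJacobi, Finset.sum_range_succ, jacobiCoeff_zero_right, jacobiCoeff_one_right]
  ring

theorem shiftedJacobi_add_two (ν : ℝ) (k : ℕ) :
    shiftedJacobi ν (k + 2) = (X - 1) * shiftedJacobi ν (k + 1) +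
      C ((ν ^ 2 - (k + 1) ^ 2) / (4 * (k + 1) ^ 2 - 1)) * shiftedJacobi ν k := by
  ext s
  rw [sub_mul, one_mul, coeff_add, coeff_sub, coeff_C_mul]
  cases s with
  | zero =>
    simp only [coeff_X_mul_zero, coeff_shiftedJacobi, Nat.zero_le, if_true, Nat.sub_zero,
      jacobiCoeff_zero_left_add_two]
    ring
  | succ s =>
    simp only [coeff_X_mul, coeff_shiftedJacobi]
    rcases lt_trichotomy s k with h | rfl | h
    · obtain ⟨d, rfl⟩ := Nat.exists_eq_add_of_lt h
      have e1 : s + d + 1 + 2 - (s + 1) = d + 2 := by omega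
      have e2 : s + d + 1 + 1 - s = d + 2 := by omega
      have e3 : s + d + 1 + 1 - (s + 1) = d + 1 := by omega
      have e4 : s + d + 1 - (s + 1) = d := by omega
      rw [if_pos (by omega), if_pos (by omega), if_pos (by omega), if_pos (by omega),
        e1, e2, e3, e4, jacobiCoeff_succ_add_two]
      have : ((s + d + 1 : ℕ) : ℝ) + 1 = s + d + 2 := by push_cast; ring
      rw [this]
    · have e1 : s + 2 - (s + 1) = 1 := by omega
      simp [e1, jacobiCoeff_one_right, jacobiCoeff_zero_right]
      ring
    · rcases Nat.eq_or_lt_of_le (Nat.succ_le_of_lt h) with rfl | h'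
      · simp [jacobiCoeff_zero_right]
      · rw [if_neg (by omega), if_neg (by omega), if_neg (by omega), if_neg (by omega)]
        simp

theorem shiftedJacobi_self (n : ℕ) : shiftedJacobi n n = X ^ n := by
  ext s
  rw [coeff_shiftedJacobi, coeff_X_pow]
  rcases lt_trichotomy s n with h | rfl | h
  · rw [if_pos h.le, if_neg h.ne]
    have : ∏ j ∈ Finset.range (n - s), ((n : ℝ) - 1 - s - j) = 0 := by
      refine Finset.prod_eq_zero (i := n - s - 1) (Finset.mem_range.2 (by omega)) ?_
      have : ((n - s - 1 : ℕ) : ℝ) = n - s - 1 := by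
        rw [Nat.cast_sub (by omega), Nat.cast_sub h.le, Nat.cast_one]
      rw [this]
      ring
    simp [jacobiCoeff, this]
  · simp [jacobiCoeff_zero_right]
  · rw [if_neg (by omega), if_neg (by omega)]

theorem det_skewTridiag_eq_shiftedJacobi {n : ℕ} {a : ℝ} (ha : a ≠ 0) {g : ℕ → ℝ}
    (hg : ∀ i : ℕ, 1 ≤ i → i + 1 ≤ n →
      g i ^ 2 = a ^ 2 * (((n : ℝ) ^ 2 - (i : ℝ) ^ 2) / (4 * (i : ℝ) ^ 2 - 1)))
    (x : ℝ) (k : ℕ) (hk : k ≤ n) :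
    (skewTridiag g x (n * a) k).det = a ^ k * (shiftedJacobi n k).eval (x / a + 1) := by
  induction k using Nat.twoStepInduction with
  | zero => simp [shiftedJacobi_zero]
  | one =>
    simp [shiftedJacobi_one, skewTridiag]
    field_simp
  | more k ih₀ ih₁ =>
    rw [det_skewTridiag_add_two, ih₀ (by omega), ih₁ (by omega), hg (k + 1) (by omega) (by omega),
      shiftedJacobi_add_two]
    simp only [eval_add, eval_mul, eval_sub, eval_X, eval_one, eval_C, Nat.cast_add, Nat.cast_one]
    have : x = a * (x / a) := by field_simp
    generalize x / a = y at *
    rw [this]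
    ring

theorem scalar_sub_Fmat (n : ℕ) (γ : ℕ → ℝ) (x ξ : ℝ) :
    scalar (Fin n) x - Fmat n γ ξ = skewTridiag (fun m => γ (n - m)) x ξ n := by
  ext i j
  have hi := i.isLt
  have hj := j.isLt
  have h (m : ℕ) (hm : m < n) : n - (n - 1 - m) = m + 1 := by omega
  simp only [skewTridiag, Fmat, scalar_apply, Matrix.sub_apply, diagonal_apply, h _ hi, h _ hj,
    Fin.ext_iff]
  split_ifs <;> first | omega | ring

theorem stmt_2 {n : ℕ} (hn : 2 ≤ n) (lam : ℝ) (hlam : lam < 0) (γ : ℕ → ℝ)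
    (hγ : ∀ i : ℕ, 1 ≤ i → i ≤ n - 1 →
      γ (n - i) = |lam| * Real.sqrt (((n : ℝ) ^ 2 - (i : ℝ) ^ 2) / (4 * (i : ℝ) ^ 2 - 1))) :
    (Fmat n γ ((n : ℝ) * |lam|)).charpoly = (X - C lam) ^ n := by
  have ha : |lam| ≠ 0 := abs_ne_zero.2 hlam.ne
  refine Polynomial.funext fun x => ?_
  rw [eval_charpoly, scalar_sub_Fmat, det_skewTridiag_eq_shiftedJacobi ha _ x n le_rfl,
    shiftedJacobi_self]
  · simp only [eval_pow, eval_X, eval_sub, eval_C]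
    rw [← mul_pow, mul_add, mul_div_cancel₀ _ ha, abs_of_neg hlam]
    ring
  · intro i hi hin
    have h1 : (1 : ℝ) ≤ i := by exact_mod_cast hi
    have h2 : (i : ℝ) ≤ n := by exact_mod_cast (by omega : i ≤ n)
    rw [hγ i hi (by omega), mul_pow, Real.sq_sqrt]
    exact div_nonneg (by nlinarith) (by nlinarith)
end

section
/- Let n ≥ 2 and let λ* < 0 be a real number. With the critically damped parameters γ_{n−i} = |λ*|·√((n²−i²)/(4i²−1)) for i = 1, …, n−1 and ξ = n·|λ*|, the matrix F(γ, ξ) − λ*·I has rank n − 1; equivalently, the eigenspace of F(γ, ξ) for the eigenvalue λ* is one-dimensional, so F(γ, ξ) has a single geometric eigenvalue. -/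
open Matrix

theorem Fmat_mulVec (n : ℕ) (γ : ℕ → ℝ) (ξ : ℝ) (f : ℕ → ℝ) (i : Fin n) :
    (Fmat n γ ξ *ᵥ fun j => f j) i =
      (if (i : ℕ) + 1 < n then γ (i + 1) * f (i + 1) else 0) +
      (if 0 < (i : ℕ) then -γ i * f (i - 1) else 0) +
      (if (i : ℕ) = n - 1 then -ξ * f i else 0) := by
  obtain ⟨i, hi⟩ := i
  simp only [mulVec, dotProduct, Fmat, add_mul, ite_mul, zero_mul, Finset.sum_add_distrib]
  rw [Fin.sum_univ_eq_sum_range (fun j => if j = i + 1 then γ (i + 1) * f j else 0),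
    Fin.sum_univ_eq_sum_range (fun j => if i = j + 1 then -γ (j + 1) * f j else 0),
    Fin.sum_univ_eq_sum_range (fun j => if i = n - 1 ∧ j = n - 1 then -ξ * f j else 0)]
  congr 1
  · congr 1
    · simp
    · rcases i with _ | i
      · simp
      · have : i < n := by omega
        simp [this]
  · by_cases h : i = n - 1
    · subst h
      simp [hi]
    · simp [h]

/-- If all `γ i` are nonzero, a vector in an eigenspace of `Fmat` is determined by its first entry. -/
theorem eq_zero_of_Fmat_sub_smul_mulVec_eq_zero {n : ℕ} (hn : 0 < n) {γ : ℕ → ℝ} {ξ lam : ℝ}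
    (hγ : ∀ i, 1 ≤ i → i < n → γ i ≠ 0) {x : Fin n → ℝ}
    (hx : (Fmat n γ ξ - lam • (1 : Matrix (Fin n) (Fin n) ℝ)) *ᵥ x = 0)
    (hx0 : x ⟨0, hn⟩ = 0) : x = 0 := by
  let f : ℕ → ℝ := fun k => if h : k < n then x ⟨k, h⟩ else 0
  have hf : x = fun j : Fin n => f j := by
    ext j
    simp [f]
  have row (i : ℕ) (hi : i < n) := congrFun hx ⟨i, hi⟩
  simp only [hf, sub_mulVec, smul_mulVec, one_mulVec, Pi.sub_apply, Pi.smul_apply, smul_eq_mul,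
    Fmat_mulVec, Pi.zero_apply] at row
  have key (k : ℕ) (hk : k < n) : f k = 0 := by
    induction k using Nat.strong_induction_on with
    | _ k ih =>
      rcases k with _ | k
      · simp [f, hn, hx0]
      · have hrow := row k (by omega)
        rw [ih k (by omega) (by omega), if_pos hk] at hrow
        rcases k with _ | k
        · simpa [hγ 1 le_rfl hk] using hrow
        · rw [Nat.add_sub_cancel, ih k (by omega) (by omega)] at hrow
          simpa [hγ (k + 1 + 1) (by omega) hk] using hrow
  rw [hf]
  ext j
  exact key j j.2

theorem rank_Fmat_sub_smul {n : ℕ} (hn : 0 < n) {γ : ℕ → ℝ} {ξ lam : ℝ}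
    (hγ : ∀ i, 1 ≤ i → i < n → γ i ≠ 0) {v : Fin n → ℝ} (hv : v ≠ 0)
    (hker : (Fmat n γ ξ - lam • (1 : Matrix (Fin n) (Fin n) ℝ)) *ᵥ v = 0) :
    (Fmat n γ ξ - lam • (1 : Matrix (Fin n) (Fin n) ℝ)).rank = n - 1 := by
  set M := Fmat n γ ξ - lam • (1 : Matrix (Fin n) (Fin n) ℝ) with hM
  have hv0 : v ⟨0, hn⟩ ≠ 0 := fun h =>
    hv (eq_zero_of_Fmat_sub_smul_mulVec_eq_zero hn hγ hker h)
  have hfin : Module.finrank ℝ (LinearMap.ker M.mulVecLin) = 1 := by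
    rw [finrank_eq_one_iff_of_nonzero' (⟨v, by simpa using hker⟩ : LinearMap.ker M.mulVecLin)
      (by simpa [Subtype.ext_iff] using hv)]
    rintro ⟨x, hx⟩
    have hx' : M *ᵥ x = 0 := by simpa using hx
    refine ⟨x ⟨0, hn⟩ / v ⟨0, hn⟩, ?_⟩
    have h := eq_zero_of_Fmat_sub_smul_mulVec_eq_zero hn hγ
      (x := x - (x ⟨0, hn⟩ / v ⟨0, hn⟩) • v)
      (by rw [← hM, mulVec_sub, mulVec_smul, hx', hker]; simp)
      (by simp [hv0])
    exact Subtype.ext (sub_eq_zero.mp h).symm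
  have := M.mulVecLin.finrank_range_add_finrank_ker
  rw [hfin, Module.finrank_fin_fun] at this
  rw [Matrix.rank]
  omega

/-- The eigenvector equations of the critically damped `Fmat`, with entries indexed from the last one
and `g k` in place of `γ (n - k)`, have a solution with last entry `1`. -/
theorem exists_recurrence_solution {n : ℕ} {m : ℝ} (hm : 0 < m) {g : ℕ → ℝ}
    (hg0 : ∀ k, 1 ≤ k → k < n → g k ≠ 0)
    (hg : ∀ k, 1 ≤ k → k < n →
      g k ^ 2 * (4 * (k : ℝ) ^ 2 - 1) = m ^ 2 * ((n : ℝ) ^ 2 - (k : ℝ) ^ 2)) :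
    ∃ w : ℕ → ℝ, w 0 = 1 ∧ ∀ k < n,
      (if 0 < k then g k * w (k - 1) else 0) +
      (if k + 1 < n then -g (k + 1) * w (k + 1) else 0) +
      (if k = 0 then -(n * m) * w k else 0) + m * w k = 0 := by
  let c : ℕ → ℝ := fun k => -(m * (n - (k + 1))) / ((2 * k + 1) * g (k + 1))
  let w : ℕ → ℝ := fun k => ∏ j ∈ Finset.range k, c j
  have step (k : ℕ) (hk : k + 1 < n) :
      (2 * k + 1) * g (k + 1) * w (k + 1) = -(m * (n - (k + 1))) * w k := by
    have := hg0 (k + 1) (by omega) hk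
    have h2 : (2 * k + 1 : ℝ) ≠ 0 := by positivity
    simp only [w, c, Finset.prod_range_succ]
    field_simp
  have up (k : ℕ) (hk : k < n) :
      (if k + 1 < n then -g (k + 1) * w (k + 1) else 0) =
        m * (n - (k + 1)) / (2 * k + 1) * w k := by
    have h2 : (2 * k + 1 : ℝ) ≠ 0 := by positivity
    split_ifs with h
    · have := step k h
      field_simp
      linear_combination -this
    · have : (n : ℝ) = k + 1 := by exact_mod_cast (by omega : n = k + 1)
      simp [this]
  refine ⟨w, by simp [w], fun k hk => ?_⟩
  rw [up k hk]
  rcases k with _ | k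
  · simp
    ring
  · have h1 := step k hk
    have h2 := hg (k + 1) (by omega) hk
    have h3 := hg0 (k + 1) (by omega) hk
    have h4 : (n - (k + 1) : ℝ) ≠ 0 := by
      have : ((k + 1 : ℕ) : ℝ) < n := by exact_mod_cast hk
      push_cast at this
      linarith
    have h5 : (2 * k + 1 : ℝ) ≠ 0 := by positivity
    have h6 : (2 * ((k : ℝ) + 1) + 1 : ℝ) ≠ 0 := by positivity
    have down : (2 * ((k : ℝ) + 1) + 1) * (g (k + 1) * w k) = -(m * (n + (k + 1))) * w (k + 1) := by
      refine mul_left_cancel₀ (mul_ne_zero hm.ne' h4) ?_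
      push_cast at h2
      linear_combination ((2 * ((k : ℝ) + 1) + 1) * g (k + 1)) * h1 - w (k + 1) * h2
    simp only [Nat.succ_pos, if_true, Nat.add_sub_cancel, Nat.succ_ne_zero, if_false]
    push_cast
    field_simp
    linear_combination down

theorem stmt_3 {n : ℕ} (hn : 2 ≤ n) (lam : ℝ) (hlam : lam < 0) (γ : ℕ → ℝ)
    (hγ : ∀ i : ℕ, 1 ≤ i → i ≤ n - 1 →
      γ (n - i) = |lam| * Real.sqrt (((n : ℝ) ^ 2 - (i : ℝ) ^ 2) / (4 * (i : ℝ) ^ 2 - 1))) :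
    (Fmat n γ ((n : ℝ) * |lam|) - lam • (1 : Matrix (Fin n) (Fin n) ℝ)).rank = n - 1 := by
  have hm : 0 < |lam| := abs_pos.mpr hlam.ne
  have hnum (k : ℕ) (hk : k < n) : 0 < (n : ℝ) ^ 2 - (k : ℝ) ^ 2 := by
    have : (k : ℝ) < n := by exact_mod_cast hk
    nlinarith [(Nat.cast_nonneg k : (0 : ℝ) ≤ k)]
  have hden (k : ℕ) (hk : 1 ≤ k) : 0 < 4 * (k : ℝ) ^ 2 - 1 := by
    have : (1 : ℝ) ≤ k := by exact_mod_cast hk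
    nlinarith
  have hg0 (k : ℕ) (h1 : 1 ≤ k) (h2 : k < n) : γ (n - k) ≠ 0 := by
    rw [hγ k h1 (by omega)]
    have := Real.sqrt_pos.mpr (div_pos (hnum k h2) (hden k h1))
    positivity
  have hg (k : ℕ) (h1 : 1 ≤ k) (h2 : k < n) :
      γ (n - k) ^ 2 * (4 * (k : ℝ) ^ 2 - 1) = |lam| ^ 2 * ((n : ℝ) ^ 2 - (k : ℝ) ^ 2) := by
    rw [hγ k h1 (by omega), mul_pow, Real.sq_sqrt (div_pos (hnum k h2) (hden k h1)).le, mul_assoc,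
      div_mul_cancel₀ _ (hden k h1).ne']
  obtain ⟨w, hw0, hw⟩ := exists_recurrence_solution hm (g := fun k => γ (n - k)) hg0 hg
  refine rank_Fmat_sub_smul (by omega) (v := fun j => w (n - 1 - j)) (fun i h1 h2 => ?_) ?_ ?_
  · have := hg0 (n - i) (by omega) (by omega)
    rwa [Nat.sub_sub_self h2.le] at this
  · intro h
    have := congrFun h ⟨n - 1, by omega⟩
    simp [hw0] at this
  · ext ⟨i, hi⟩
    rw [sub_mulVec, smul_mulVec, one_mulVec, Pi.sub_apply,
      Fmat_mulVec n γ _ (fun j => w (n - 1 - j))]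
    have h := hw (n - 1 - i) (by omega)
    simp only [Pi.smul_apply, smul_eq_mul, Pi.zero_apply]
    rw [abs_of_neg hlam] at h ⊢
    have e1 : (if 0 < n - 1 - i then γ (n - (n - 1 - i)) * w (n - 1 - i - 1) else 0) =
        if i + 1 < n then γ (i + 1) * w (n - 1 - (i + 1)) else 0 := by
      rw [Nat.sub_sub (n - 1) i 1, show n - (n - 1 - i) = i + 1 by omega]
      exact if_congr (by omega) rfl rfl
    have e2 : (if n - 1 - i + 1 < n then -γ (n - (n - 1 - i + 1)) * w (n - 1 - i + 1) else 0) =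
        if 0 < i then -γ i * w (n - 1 - (i - 1)) else 0 := by
      refine ite_congr (propext (by omega)) (fun h => ?_) (fun _ => rfl)
      rw [show n - (n - 1 - i + 1) = i by omega, show n - 1 - (i - 1) = n - 1 - i + 1 by omega]
    have e3 : (n - 1 - i = 0) = (i = n - 1) := propext (by omega)
    simp only [e1, e2, e3] at h
    linear_combination h
end

section
/- Let n ≥ 2 and let γ_1, …, γ_{n−1} be real numbers. Define polynomials d_j by d_0(λ) = 1, d_1(λ) = −λ, and d_{j+1}(λ) = −λ·d_j(λ) + γ_j²·d_{j−1}(λ) for 1 ≤ j ≤ n−1. Then for every 1 ≤ j ≤ n and every real λ: d_j(λ) = (−1)^j · Σ_{k=0}^{⌊j/2⌋} λ^{j−2k} · s_{j−1,k}. -/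
/-- `sAux γ m k = s_{m-1, k}` : a shifted version (by one in the first index) of the
double sequence `s_{j,k}` (defined for integers `j ≥ -1`), so that `sAux γ 0 k = s_{-1,k}`. -/
def sAux (γ : ℕ → ℝ) : ℕ → ℕ → ℝ
  | _, 0 => 1
  | 0, _ + 1 => 0
  | 1, _ + 1 => 0
  | (m + 2), (k + 1) =>
      if m + 1 ≤ 2 * k then 0
      else (γ (m + 1)) ^ 2 * sAux γ m k + sAux γ (m + 1) (k + 1)
  termination_by m k => (m, k)

/-- The double sequence `s_{j,k}` for integers `j ≥ -1` and naturals `k`: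
`s_{j,0} = 1`; `s_{j,k} = 0` if `k ≥ 1` and `j ≤ 2k−2`; and
`s_{j,k} = γ_j² · s_{j−2,k−1} + s_{j−1,k}` if `k ≥ 1` and `j > 2k−2`. -/
def sSeq (γ : ℕ → ℝ) (j : ℤ) (k : ℕ) : ℝ := sAux γ (j + 1).toNat k

/-- The polynomials `d_j` defined by the recurrence
`d_0(λ) = 1`, `d_1(λ) = −λ`, `d_{j+1}(λ) = −λ·d_j(λ) + γ_j²·d_{j−1}(λ)`. -/
def dRec (γ : ℕ → ℝ) : ℕ → ℝ → ℝ
  | 0, _ => 1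
  | 1, l => -l
  | (j + 2), l => -l * dRec γ (j + 1) l + (γ (j + 1)) ^ 2 * dRec γ j l

theorem sAux_zero_right (γ : ℕ → ℝ) (m : ℕ) : sAux γ m 0 = 1 := by
  rw [sAux]

theorem sAux_eq_zero_of_lt (γ : ℕ → ℝ) {m k : ℕ} (h : m < 2 * k) : sAux γ m k = 0 := by
  match m, k with
  | _, 0 => omega
  | 0, _ + 1 => rw [sAux]
  | 1, _ + 1 => rw [sAux]
  | m + 2, k + 1 => rw [sAux, if_pos (by omega)]

theorem sAux_add_two_succ (γ : ℕ → ℝ) (m k : ℕ) :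
    sAux γ (m + 2) (k + 1) = γ (m + 1) ^ 2 * sAux γ m k + sAux γ (m + 1) (k + 1) := by
  rw [sAux]
  split_ifs with h
  · rw [sAux_eq_zero_of_lt γ (by omega : m < 2 * k),
      sAux_eq_zero_of_lt γ (by omega : m + 1 < 2 * (k + 1))]
    ring
  · rfl

theorem sum_range_sAux_eq (γ : ℕ → ℝ) (l : ℝ) {m N : ℕ} (h : m / 2 + 1 ≤ N) :
    ∑ k ∈ Finset.range (m / 2 + 1), l ^ (m - 2 * k) * sAux γ m k
      = ∑ k ∈ Finset.range N, l ^ (m - 2 * k) * sAux γ m k := by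
  refine Finset.sum_subset (Finset.range_subset_range.2 h) fun k _ hk => ?_
  rw [Finset.mem_range] at hk
  rw [sAux_eq_zero_of_lt γ (by omega), mul_zero]

theorem sum_range_sAux_add_two (γ : ℕ → ℝ) (l : ℝ) (m : ℕ) :
    ∑ k ∈ Finset.range ((m + 2) / 2 + 1), l ^ (m + 2 - 2 * k) * sAux γ (m + 2) k
      = l * ∑ k ∈ Finset.range ((m + 1) / 2 + 1), l ^ (m + 1 - 2 * k) * sAux γ (m + 1) k
        + γ (m + 1) ^ 2 * ∑ k ∈ Finset.range (m / 2 + 1), l ^ (m - 2 * k) * sAux γ m k := by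
  rw [sum_range_sAux_eq γ l (by omega : (m + 1) / 2 + 1 ≤ m / 2 + 1 + 1),
    (by omega : (m + 2) / 2 + 1 = m / 2 + 1 + 1), Finset.sum_range_succ',
    Finset.sum_range_succ' _ (m / 2 + 1), mul_add, Finset.mul_sum, Finset.mul_sum,
    add_right_comm, ← Finset.sum_add_distrib]
  congr 1
  · refine Finset.sum_congr rfl fun k _ => ?_
    rw [sAux_add_two_succ, (by omega : m + 2 - 2 * (k + 1) = m - 2 * k)]
    rcases lt_or_ge (m + 1) (2 * (k + 1)) with h | h
    · rw [sAux_eq_zero_of_lt γ h]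
      ring
    · rw [(by omega : m - 2 * k = (m + 1 - 2 * (k + 1)) + 1), pow_succ]
      ring
  · simp only [sAux_zero_right, mul_zero, Nat.sub_zero]
    ring

theorem dRec_eq_sum_sAux (γ : ℕ → ℝ) (l : ℝ) (j : ℕ) :
    dRec γ j l
      = (-1 : ℝ) ^ j * ∑ k ∈ Finset.range (j / 2 + 1), l ^ (j - 2 * k) * sAux γ j k := by
  induction j using Nat.twoStepInduction with
  | zero => simp [dRec, sAux_zero_right]
  | one => simp [dRec, sAux_zero_right]
  | more m ih₀ ih₁ =>
    rw [dRec, ih₀, ih₁, sum_range_sAux_add_two]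
    ring

theorem stmt_7 {n : ℕ} (hn : 2 ≤ n) (γ : ℕ → ℝ) :
    ∀ j : ℕ, 1 ≤ j → j ≤ n → ∀ l : ℝ,
      dRec γ j l
        = (-1 : ℝ) ^ j *
            ∑ k ∈ Finset.range (j / 2 + 1),
              l ^ (j - 2 * k) * sSeq γ ((j : ℤ) - 1) k := by
  intro j _ _ l
  simpa [sSeq] using dRec_eq_sum_sAux γ l j
end

section
/- Let n ≥ 2, let γ_1, …, γ_{n−1}, ξ be real numbers, and let λ* be a real number. Define the sequence s_{j,k} from γ as usual. Suppose the characteristic polynomial of F(γ, ξ) equals (X − λ*)ⁿ, i.e., (−1)ⁿ·Σ_{k=0}^{⌊n/2⌋} λ^{n−2k}·s_{n−1,k} − (−1)^{n−1}·ξ·Σ_{k=0}^{⌊(n−1)/2⌋} λ^{n−2k−1}·s_{n−2,k} = (λ* − λ)ⁿ for all real λ. Then ξ = −n·λ*, and moreover s_{n−1,k} = C(n, 2k)·λ*^{2k} for all 0 ≤ k ≤ ⌊n/2⌋ and ξ·s_{n−2,k} = C(n, 2k+1)·(−λ*)^{2k+1} for all 0 ≤ k ≤ ⌊(n−1)/2⌋.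 -/
open Polynomial in
/-- If `(l - lam) ^ n` is the sum of its parts of even and odd codegree in `l`, then the coefficients
of these parts are given by the binomial theorem. -/
theorem even_odd_coeff_of_eval_eq_sub_pow {n : ℕ} (hn : 1 ≤ n) (a b : ℕ → ℝ) (lam : ℝ)
    (h : ∀ l : ℝ,
      ∑ k ∈ Finset.range (n / 2 + 1), l ^ (n - 2 * k) * a k +
        ∑ k ∈ Finset.range ((n - 1) / 2 + 1), l ^ (n - 2 * k - 1) * b k = (l - lam) ^ n) :
    (∀ k ≤ n / 2, a k = (n.choose (2 * k) : ℝ) * lam ^ (2 * k)) ∧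
    (∀ k ≤ (n - 1) / 2, b k = (n.choose (2 * k + 1) : ℝ) * (-lam) ^ (2 * k + 1)) := by
  have hP : ∑ k ∈ Finset.range (n / 2 + 1), C (a k) * X ^ (n - 2 * k) +
      ∑ k ∈ Finset.range ((n - 1) / 2 + 1), C (b k) * X ^ (n - 2 * k - 1) =
        (X + C (-lam)) ^ n := by
    refine Polynomial.funext fun l => ?_
    simp only [eval_add, eval_finsetSum, eval_mul, eval_C, eval_pow, eval_X]
    simpa only [mul_comm, sub_eq_add_neg] using h l
  refine ⟨fun k hk => ?_, fun k hk => ?_⟩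
  · have hc := congrArg (fun p => p.coeff (n - 2 * k)) hP
    simp only [coeff_add, finsetSum_coeff, coeff_C_mul, coeff_X_pow, coeff_X_add_C_pow] at hc
    rw [Finset.sum_eq_single k, Finset.sum_eq_zero, Nat.choose_symm (by omega),
      Nat.sub_sub_self (by omega)] at hc
    · simpa [mul_comm] using hc
    · intro i hi
      rw [Finset.mem_range] at hi
      rw [if_neg (by omega), mul_zero]
    · intro i hi hik
      rw [Finset.mem_range] at hi
      rw [if_neg (by omega), mul_zero]
    · intro hk'
      exact absurd (Finset.mem_range.2 (by omega)) hk'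
  · have hc := congrArg (fun p => p.coeff (n - (2 * k + 1))) hP
    simp only [coeff_add, finsetSum_coeff, coeff_C_mul, coeff_X_pow, coeff_X_add_C_pow] at hc
    rw [Finset.sum_eq_zero, Finset.sum_eq_single k, Nat.choose_symm (by omega),
      Nat.sub_sub_self (by omega)] at hc
    · simpa [mul_comm, Nat.sub_sub] using hc
    · intro i hi hik
      rw [Finset.mem_range] at hi
      rw [if_neg (by omega), mul_zero]
    · intro hk'
      exact absurd (Finset.mem_range.2 (by omega)) hk'
    · intro i hi
      rw [Finset.mem_range] at hi
      rw [if_neg (by omega), mul_zero]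

theorem stmt_9 {n : ℕ} (hn : 2 ≤ n) (γ : ℕ → ℝ) (ξ lam : ℝ)
    (hchar : ∀ l : ℝ,
      (-1 : ℝ) ^ n *
          ∑ k ∈ Finset.range (n / 2 + 1), l ^ (n - 2 * k) * sSeq γ ((n : ℤ) - 1) k -
        (-1 : ℝ) ^ (n - 1) * ξ *
          ∑ k ∈ Finset.range ((n - 1) / 2 + 1),
            l ^ (n - 2 * k - 1) * sSeq γ ((n : ℤ) - 2) k
        = (lam - l) ^ n) :
    ξ = -(n : ℝ) * lam ∧
    (∀ k : ℕ, k ≤ n / 2 →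
      sSeq γ ((n : ℤ) - 1) k = (n.choose (2 * k) : ℝ) * lam ^ (2 * k)) ∧
    (∀ k : ℕ, k ≤ (n - 1) / 2 →
      ξ * sSeq γ ((n : ℤ) - 2) k = (n.choose (2 * k + 1) : ℝ) * (-lam) ^ (2 * k + 1)) := by
  have hsq : (-1 : ℝ) ^ n * (-1) ^ n = 1 := by rw [← mul_pow]; simp
  have hpred : (-1 : ℝ) ^ (n - 1) = -(-1) ^ n := by
    obtain ⟨m, rfl⟩ : ∃ m, n = m + 1 := ⟨n - 1, by omega⟩
    rw [Nat.add_sub_cancel, pow_succ]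
    ring
  obtain ⟨heven, hodd⟩ := even_odd_coeff_of_eval_eq_sub_pow (n := n) (by omega)
    (fun k => sSeq γ ((n : ℤ) - 1) k) (fun k => ξ * sSeq γ ((n : ℤ) - 2) k) lam (fun l => by
      have hl := hchar l
      rw [hpred] at hl
      have hpow : (l - lam) ^ n = (-1 : ℝ) ^ n * (lam - l) ^ n := by
        rw [← mul_pow]
        ring
      simp only [mul_left_comm _ ξ, ← Finset.mul_sum]
      rw [hpow, ← hl]
      linear_combination (-(∑ k ∈ Finset.range (n / 2 + 1),
          l ^ (n - 2 * k) * sSeq γ ((n : ℤ) - 1) k) - ξ * ∑ k ∈ Finset.range ((n - 1) / 2 + 1),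
          l ^ (n - 2 * k - 1) * sSeq γ ((n : ℤ) - 2) k) * hsq)
  refine ⟨?_, heven, hodd⟩
  have h0 := hodd 0 (Nat.zero_le _)
  simpa [sSeq, sAux] using h0
end

section
/- Let n ≥ 2, let λ* be a nonzero real number, and let γ_1, …, γ_{n−1} be real numbers whose associated sequence s_{j,k} satisfies the closed form s_{n−i,k} = [C(i+k−1, k)/C(2(i+k−1), 2k)] · C(n−i+1, 2k) · λ*^{2k} for all integers i, k with 1 ≤ i ≤ n−1, k ≥ 0 and n−i > 2k−2. Then for every 1 ≤ i ≤ n−1: γ_{n−i}² = ((n²−i²)/(4i²−1))·λ*². -/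
/-- The column `k = 1` of the sequence grows by `γ_j ^ 2` at each step `j = m + 1 ≥ 1`. -/
lemma sAux_add_two_one (γ : ℕ → ℝ) (m : ℕ) :
    sAux γ (m + 2) 1 = γ (m + 1) ^ 2 + sAux γ (m + 1) 1 := by
  rw [sAux]
  simp [sAux]

theorem stmt_10 {n : ℕ} (hn : 2 ≤ n) (lam : ℝ) (hlam : lam ≠ 0) (γ : ℕ → ℝ)
    (hs : ∀ i k : ℕ, 1 ≤ i → i ≤ n - 1 → (2 * (k : ℤ) - 2 < (n : ℤ) - i) →
      sSeq γ ((n : ℤ) - i) k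
        = ((i + k - 1).choose k : ℝ) / ((2 * (i + k - 1)).choose (2 * k) : ℝ) *
            ((n - i + 1).choose (2 * k) : ℝ) * lam ^ (2 * k)) :
    ∀ i : ℕ, 1 ≤ i → i ≤ n - 1 →
      (γ (n - i)) ^ 2
        = (((n : ℝ) ^ 2 - (i : ℝ) ^ 2) / (4 * (i : ℝ) ^ 2 - 1)) * lam ^ 2 := by
  intro i hi hin
  obtain ⟨m, rfl⟩ : ∃ m, n = i + (m + 1) := ⟨n - i - 1, by omega⟩
  have hi1 : (1 : ℝ) ≤ i := by exact_mod_cast hi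
  have hcol : ∀ i' m' : ℕ, 1 ≤ i' → i' + (m' + 1) = i + (m + 1) →
      sAux γ (m' + 2) 1 = (m' + 2) * (m' + 1) / (2 * (2 * i' - 1)) * lam ^ 2 := by
    intro i' m' hi' hsum
    have h := hs i' 1 hi' (by omega) (by omega)
    have hpos : (1 : ℝ) ≤ i' := by exact_mod_cast hi'
    have e1 : (((i + (m + 1) : ℕ) : ℤ) - i' + 1).toNat = m' + 2 := by omega
    have e2 : i + (m + 1) - i' + 1 = m' + 2 := by omega
    rw [sSeq, e1, e2] at h
    simp only [Nat.add_sub_cancel, mul_one, Nat.choose_one_right, Nat.cast_choose_two] at h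
    rw [h]
    push_cast
    have h1 : (2 * i' - 1 : ℝ) ≠ 0 := by linarith
    have h2 : (i' : ℝ) ≠ 0 := by linarith
    field_simp
    ring
  have hprev : sAux γ (m + 1) 1 = (m + 1) * m / (2 * (2 * i + 1)) * lam ^ 2 := by
    cases m with
    | zero => simp [sAux]
    | succ m =>
      rw [hcol (i + 1) m (by omega) (by omega)]
      push_cast
      ring
  have hγ := sAux_add_two_one γ m
  rw [hcol i m hi rfl, hprev] at hγ
  rw [Nat.add_sub_cancel_left, ← sub_eq_of_eq_add hγ]
  have h1 : (2 * i - 1 : ℝ) ≠ 0 := by linarith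
  have h2 : (2 * i + 1 : ℝ) ≠ 0 := by linarith
  have h3 : (4 * (i : ℝ) ^ 2 - 1) = (2 * i - 1) * (2 * i + 1) := by ring
  rw [h3]
  push_cast
  field_simp
  ring
end

section
/- Let n ≥ 2 and let λ* be a real number. Define S(n−i, k) = [C(i+k−1, k)/C(2(i+k−1), 2k)] · C(n−i+1, 2k) · λ*^{2k}. Then for all integers i, k with 1 ≤ i ≤ n−1, k ≥ 1 and n−i > 2k−2: ((n²−i²)/(4i²−1))·λ*² · S(n−i−2, k−1) + S(n−i−1, k) = S(n−i, k). Consequently, setting γ_{n−i}² = ((n²−i²)/(4i²−1))·λ*², the closed form S(j, k) satisfies the defining recurrence of the sequence s_{j,k}, so s_{n−i,k} = S(n−i,k) for all valid indices. -/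
/-- The closed form `S(n−i, k) = [C(i+k−1, k)/C(2(i+k−1), 2k)] · C(n−i+1, 2k) · λ*^{2k}`,
written as a function of `i` and `k`. -/
noncomputable def Sform (n : ℕ) (lam : ℝ) (i k : ℕ) : ℝ :=
  ((i + k - 1).choose k : ℝ) / ((2 * (i + k - 1)).choose (2 * k) : ℝ) *
    ((n - i + 1).choose (2 * k) : ℝ) * lam ^ (2 * k)

open Nat in
/-- The ratio of binomials in `Sform`, expressed through factorials. -/
theorem choose_div_choose_two_mul (a k : ℕ) :
    ((a + k).choose k : ℝ) / ((2 * (a + k)).choose (2 * k) : ℝ) =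
      ((a + k)! * (2 * k)! * (2 * a)!) / (k ! * a ! * (2 * a + 2 * k)!) := by
  have h1 : ((a + k).choose k : ℝ) = (a + k)! / (k ! * a !) := by
    rw [add_comm a k, Nat.cast_add_choose]
  have h2 : ((2 * (a + k)).choose (2 * k) : ℝ) =
      (2 * a + 2 * k)! / ((2 * k)! * (2 * a)!) := by
    rw [mul_add, add_comm (2 * a), Nat.cast_add_choose]
  have f (m : ℕ) : (m ! : ℝ) ≠ 0 := by exact_mod_cast m.factorial_ne_zero
  have := f k
  have := f a
  have := f (2 * k)
  have := f (2 * a)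
  have := f (2 * a + 2 * k)
  rw [h1, h2]
  field_simp

theorem choose_div_choose_two_mul_succ_left (a k : ℕ) :
    ((a + 1 + k).choose k : ℝ) / ((2 * (a + 1 + k)).choose (2 * k) : ℝ) * (2 * a + 2 * k + 1) =
      ((a + k).choose k : ℝ) / ((2 * (a + k)).choose (2 * k) : ℝ) * (2 * a + 1) := by
  have f (m : ℕ) : (m.factorial : ℝ) ≠ 0 := by exact_mod_cast m.factorial_ne_zero
  have := f k
  have := f a
  have := f (2 * a + 2 * k)
  rw [choose_div_choose_two_mul, choose_div_choose_two_mul,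
    show a + 1 + k = (a + k) + 1 by ring, show 2 * (a + 1) = 2 * a + 1 + 1 by ring,
    show 2 * a + 1 + 1 + 2 * k = 2 * a + 2 * k + 1 + 1 by ring]
  simp only [Nat.factorial_succ]
  push_cast
  field_simp
  ring

theorem choose_div_choose_two_mul_exchange (a k : ℕ) :
    ((a + 1 + k).choose k : ℝ) / ((2 * (a + 1 + k)).choose (2 * k) : ℝ) * (2 * k + 1) =
      ((a + (k + 1)).choose (k + 1) : ℝ) / ((2 * (a + (k + 1))).choose (2 * (k + 1)) : ℝ) *
        (2 * a + 1) := by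
  have f (m : ℕ) : (m.factorial : ℝ) ≠ 0 := by exact_mod_cast m.factorial_ne_zero
  have := f k
  have := f a
  have := f (2 * a + 2 * k + 1 + 1)
  rw [choose_div_choose_two_mul, choose_div_choose_two_mul,
    show a + 1 + k = (a + k) + 1 by ring, show a + (k + 1) = (a + k) + 1 by ring,
    show 2 * (a + 1) = 2 * a + 1 + 1 by ring, show 2 * (k + 1) = 2 * k + 1 + 1 by ring,
    show 2 * a + 1 + 1 + 2 * k = 2 * a + 2 * k + 1 + 1 by ring,
    show 2 * a + (2 * k + 1 + 1) = 2 * a + 2 * k + 1 + 1 by ring]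
  simp only [Nat.factorial_succ k, Nat.factorial_succ a, Nat.factorial_succ (2 * a + 1),
    Nat.factorial_succ (2 * a), Nat.factorial_succ (2 * k + 1), Nat.factorial_succ (2 * k)]
  push_cast
  field_simp
  ring

theorem choose_quadratic_identity (x : ℝ) (m k : ℕ) :
    ((m : ℝ) + 1) * (m + 1 + 2 * x) * (m.choose (2 * k) : ℝ) +
        (2 * k + 1) * (2 * x - 1) * ((m + 1).choose (2 * k + 2) : ℝ) =
      (2 * k + 1) * (2 * x + 2 * k + 1) * ((m + 2).choose (2 * k + 2) : ℝ) := by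
  have h1 : ((m : ℝ) + 1) * m.choose (2 * k) = (m + 1).choose (2 * k + 1) * (2 * k + 1) := by
    exact_mod_cast Nat.add_one_mul_choose_eq m (2 * k)
  have h2 : ((m : ℝ) + 2) * (m + 1).choose (2 * k + 1) =
      (m + 2).choose (2 * k + 2) * (2 * k + 2) := by
    exact_mod_cast Nat.add_one_mul_choose_eq (m + 1) (2 * k + 1)
  have h3 : ((m + 2).choose (2 * k + 2) : ℝ) =
      (m + 1).choose (2 * k + 1) + (m + 1).choose (2 * k + 2) := by
    exact_mod_cast Nat.choose_succ_succ (m + 1) (2 * k + 1)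
  rw [h3] at h2 ⊢
  linear_combination (m + 1 + 2 * x) * h1 + (2 * k + 1) * h2

theorem Sform_zero (n : ℕ) (lam : ℝ) (i : ℕ) : Sform n lam i 0 = 1 := by
  simp [Sform]

theorem Sform_eq_zero {n i k : ℕ} (lam : ℝ) (h : n - i + 1 < 2 * k) : Sform n lam i k = 0 := by
  simp [Sform, Nat.choose_eq_zero_of_lt h]

theorem Sform_recurrence {n i k : ℕ} (lam : ℝ) (hi : 1 ≤ i) (hin : i < n)
    (hk : 2 * k < n - i) :
    (((n : ℝ) ^ 2 - (i : ℝ) ^ 2) / (4 * (i : ℝ) ^ 2 - 1)) * lam ^ 2 *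
        Sform n lam (i + 2) k + Sform n lam (i + 1) (k + 1) = Sform n lam i (k + 1) := by
  obtain ⟨a, rfl⟩ : ∃ a, i = a + 1 := ⟨i - 1, by omega⟩
  obtain ⟨m, rfl⟩ : ∃ m, n = a + 1 + (m + 1) := ⟨n - (a + 1) - 1, by omega⟩
  have hc : (a + 1 + (m + 1) - (a + 1 + 2) + 1).choose (2 * k) = m.choose (2 * k) := by
    rcases m with _ | m
    · obtain rfl : k = 0 := by omega
      simp
    · congr 1
      omega
  unfold Sform
  rw [hc, show a + 1 + 2 + k - 1 = a + 1 + 1 + k by omega,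
    show a + 1 + 1 + (k + 1) - 1 = a + 1 + (k + 1) by omega,
    show a + 1 + (k + 1) - 1 = a + (k + 1) by omega,
    show a + 1 + (m + 1) - (a + 1 + 1) + 1 = m + 1 by omega,
    show a + 1 + (m + 1) - (a + 1) + 1 = m + 2 by omega]
  have h1 := choose_div_choose_two_mul_exchange (a + 1) k
  have h2 := choose_div_choose_two_mul_succ_left a (k + 1)
  have h3 := choose_quadratic_identity (a + 1) m k
  generalize ((a + 1 + 1 + k).choose k : ℝ) / _ = A at *
  generalize ((a + 1 + (k + 1)).choose (k + 1) : ℝ) / _ = B at *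
  generalize ((a + (k + 1)).choose (k + 1) : ℝ) / _ = C at *
  rw [show 2 * (k + 1) = 2 * k + 2 by ring]
  generalize (m.choose (2 * k) : ℝ) = c₀ at *
  generalize ((m + 1).choose (2 * k + 2) : ℝ) = c₁ at *
  generalize ((m + 2).choose (2 * k + 2) : ℝ) = c₂ at *
  push_cast at *
  have hB : B = C * (2 * a + 1) / (2 * a + 2 * k + 3) := by
    rw [eq_div_iff (by positivity)]
    linear_combination h2
  have hA : A = B * (2 * a + 3) / (2 * k + 1) := by
    rw [eq_div_iff (by positivity)]
    linear_combination h1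
  have hd : (4 * ((a : ℝ) + 1) ^ 2 - 1) = (2 * a + 1) * (2 * a + 3) := by ring
  rw [hA, hB, hd]
  field_simp
  linear_combination lam ^ (2 * k + 2) * C * h3

theorem sAux_eq_Sform {n : ℕ} {lam : ℝ} {γ : ℕ → ℝ}
    (hγ : ∀ i : ℕ, 1 ≤ i → i ≤ n - 1 →
      (γ (n - i)) ^ 2 = (((n : ℝ) ^ 2 - (i : ℝ) ^ 2) / (4 * (i : ℝ) ^ 2 - 1)) * lam ^ 2)
    (m k i : ℕ) (hi : 1 ≤ i) (him : i + m = n + 1) : sAux γ m k = Sform n lam i k := by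
  induction m using Nat.strong_induction_on generalizing k i with
  | _ m ih =>
    rcases k with _ | k
    · rw [Sform_zero, sAux]
    rcases m with _ | _ | m
    · rw [sAux, Sform_eq_zero lam (by omega)]
    · rw [sAux, Sform_eq_zero lam (by omega)]
    · rw [sAux]
      split_ifs with h
      · rw [Sform_eq_zero lam (by omega)]
      · rw [ih m (by omega) k (i + 2) (by omega) (by omega),
          ih (m + 1) (by omega) (k + 1) (i + 1) (by omega) (by omega),
          show m + 1 = n - i by omega, hγ i hi (by omega)]
        exact Sform_recurrence lam hi (by omega) (by omega)

theorem stmt_11 {n : ℕ} (hn : 2 ≤ n) (lam : ℝ) :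
    (∀ i k : ℕ, 1 ≤ i → i ≤ n - 1 → 1 ≤ k → (2 * (k : ℤ) - 2 < (n : ℤ) - i) →
      (((n : ℝ) ^ 2 - (i : ℝ) ^ 2) / (4 * (i : ℝ) ^ 2 - 1)) * lam ^ 2 *
          Sform n lam (i + 2) (k - 1) + Sform n lam (i + 1) k
        = Sform n lam i k) ∧
    (∀ γ : ℕ → ℝ,
      (∀ i : ℕ, 1 ≤ i → i ≤ n - 1 →
        (γ (n - i)) ^ 2
          = (((n : ℝ) ^ 2 - (i : ℝ) ^ 2) / (4 * (i : ℝ) ^ 2 - 1)) * lam ^ 2) →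
      ∀ i k : ℕ, 1 ≤ i → i ≤ n - 1 → (2 * (k : ℤ) - 2 < (n : ℤ) - i) →
        sSeq γ ((n : ℤ) - i) k = Sform n lam i k) := by
  refine ⟨fun i k hi hin hk h => ?_, fun γ hγ i k hi hin _ => ?_⟩
  · obtain ⟨k, rfl⟩ : ∃ l, k = l + 1 := ⟨k - 1, by omega⟩
    exact Sform_recurrence lam hi (by omega) (by omega)
  · exact sAux_eq_Sform hγ _ k i hi (by omega)
end
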